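/- Let K be an n×n complex matrix, a : Fin n an index with K a a ≠ 1, and B a finset of Fin n with a ∉ B. Then det(K_B) − det(K_{B ∪ {a}}) = (1 − K a a) · det(K_B − (K a a − 1)⁻¹ · K_{B,{a}} · K_{{a},B}). -/

import Mathlib

open Matrix

/-- The submatrix of `K` with rows indexed by `A` and columns indexed by `B`. -/
def kSub {n : ℕ} (K : Matrix (Fin n) (Fin n) ℂ) (A B : Finset (Fin n)) :
    Matrix A B ℂ :=
  Matrix.of fun i j => K i j

/-- `p` is a determinantal point process with marginal kernel `K`:
`p` is a probability mass function on finsets of `Fin n` and for every finset `Y`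
the probability that `Y` is contained in the sample equals `det (K_Y)`. -/
def IsDPP {n : ℕ} (K : Matrix (Fin n) (Fin n) ℂ) (p : Finset (Fin n) → ℝ) : Prop :=
  (∀ S, 0 ≤ p S) ∧ (∑ S : Finset (Fin n), p S = 1) ∧
    ∀ Y : Finset (Fin n),
      ((∑ S ∈ Finset.univ.filter fun S => Y ⊆ S, p S : ℝ) : ℂ) =
        (kSub K Y Y).det

theorem aux_lin {m : Type*} [Fintype m] [DecidableEq m] {s : Type*} [Fintype s] [DecidableEq s]
    [Unique s] (c : ℂ) (v : Matrix s m ℂ) (u : Matrix m s ℂ) (D : Matrix m m ℂ) :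
    (fromBlocks (of fun _ _ => c) v u D).det =
      (fromBlocks (of fun _ _ => c - 1) v u D).det + D.det := by
  have h1 : D.det = (fromBlocks (1 : Matrix s s ℂ) 0 u D).det := by
    rw [det_fromBlocks_zero₁₂]; simp
  have e : ∀ (A : Matrix s s ℂ) (w : Matrix s m ℂ), fromBlocks A w u D =
      (fromBlocks 0 0 u D).updateRow (Sum.inl default) (Sum.elim (A default) (w default)) := by
    intro A w
    ext i j
    rcases i with i | i
    · obtain rfl := Unique.eq_default i
      rw [updateRow_self]
      rcases j with j | j <;> simp
    · rw [updateRow_ne (by simp)]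
      rcases j with j | j <;> simp
  rw [h1, e _ v, e _ v, e 1 0, ← det_updateRow_add]
  congr 2
  ext j
  rcases j with j | j
  · obtain rfl := Unique.eq_default j
    simp
  · simp

theorem aux_schur {m : Type*} [Fintype m] [DecidableEq m] {s : Type*} [Fintype s] [DecidableEq s]
    [Unique s] (c : ℂ) (hc : c ≠ 0) (v : Matrix s m ℂ) (u : Matrix m s ℂ) (D : Matrix m m ℂ) :
    (fromBlocks (of fun _ _ => c) v u D).det = c * (D - c⁻¹ • (u * v)).det := by
  have hA : (of fun _ _ => c : Matrix s s ℂ) = c • 1 := by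
    ext i j
    obtain rfl := Unique.eq_default i
    obtain rfl := Unique.eq_default j
    simp
  letI : Invertible (c • (1 : Matrix s s ℂ)) :=
    ⟨c⁻¹ • 1, by simp [smul_smul, hc], by simp [smul_smul, hc]⟩
  rw [hA, det_fromBlocks₁₁]
  have : ⅟(c • (1 : Matrix s s ℂ)) = c⁻¹ • 1 := rfl
  rw [this]
  simp

theorem stmt_4 {n : ℕ} (K : Matrix (Fin n) (Fin n) ℂ) (a : Fin n)
    (ha : K a a ≠ 1) (B : Finset (Fin n)) (haB : a ∉ B) :
    (kSub K B B).det - (kSub K (insert a B) (insert a B)).det =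
      (1 - K a a) *
        (kSub K B B - (K a a - 1)⁻¹ • (kSub K B {a} * kSub K {a} B)).det := by
  classical
  let f : ({a} : Finset (Fin n)) ⊕ B → (insert a B : Finset (Fin n)) :=
    Sum.elim (fun x => ⟨x.1, Finset.mem_insert.2 (Or.inl (Finset.mem_singleton.1 x.2))⟩) (fun x => ⟨x.1, by simp [x.2]⟩)
  have hf : Function.Bijective f := by
    constructor
    · rintro (⟨x, hx⟩ | ⟨x, hx⟩) (⟨y, hy⟩ | ⟨y, hy⟩) h <;>
        simp [f] at h hx hy ⊢ <;> grind
    · rintro ⟨x, hx⟩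
      rcases Finset.mem_insert.1 hx with h | h
      · exact ⟨Sum.inl ⟨x, by simp [h]⟩, rfl⟩
      · exact ⟨Sum.inr ⟨x, h⟩, rfl⟩
  have key : (kSub K (insert a B) (insert a B)).det =
      (fromBlocks (of fun _ _ => K a a) (kSub K {a} B) (kSub K B {a}) (kSub K B B)).det := by
    rw [← det_submatrix_equiv_self (Equiv.ofBijective f hf)]
    congr 1
    ext i j
    rcases i with ⟨i, hi⟩ | i <;> rcases j with ⟨j, hj⟩ | j
    · obtain rfl := Finset.mem_singleton.1 hi
      obtain rfl := Finset.mem_singleton.1 hj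
      rfl
    all_goals rfl
  rw [key, aux_lin, aux_schur _ (sub_ne_zero.2 ha)]
  ring
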